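/- Let n ≥ 1, let 0 ≤ σ₁ ≤ σ₃, and let (M_k)_{k≥0} be an increasing sequence of positive real numbers. Let f : ℝⁿ → ℂ be C^∞ and satisfy |f(x)| ≤ M₀ ⟨x⟩^{−σ₁} for all x, and Σ_{|γ|=k} |∂_x^γ f(x)| ≤ M_k ⟨x⟩^{−(k+σ₃)} for all x and every k ≥ 1. Then there exists a C^∞ function F : ℝⁿ_x × ℝⁿ_y → ℂ such that: (i) F(x,0) = f(x) for all x; (ii) there is C₀ with |F(x,y)| ≤ C₀ ⟨x⟩^{−σ₁} for all (x,y); (iii) for all multi-indices A, B ∈ ℕⁿ with |A| + |B| ≥ 1 there is C_{AB} with |∂_x^A ∂_y^B F(x,y)| ≤ C_{AB} ⟨x⟩^{−(|A|+|B|+σ₃)} for all (x,y); (iv) for every N ∈ ℕ there is C_N such that for j = 1,…,n and all (x,y), |∂̄_j F(x,y)| ≤ C_N (|y|/⟨x⟩)^N ⟨x⟩^{−(1+σ₃)}, where ∂̄_j = (1/2)(∂/∂x_j + i ∂/∂y_j). -/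

import Mathlib

open scoped BigOperators

noncomputable section

namespace Paper

/-- `ℝⁿ` with the Euclidean norm. -/
abbrev Eu (n : ℕ) := EuclideanSpace ℝ (Fin n)

/-- The Japanese bracket `⟨x⟩ = (1 + |x|²)^{1/2}`. -/
def jb {n : ℕ} (x : Eu n) : ℝ := Real.sqrt (1 + ‖x‖ ^ 2)

/-- First-order partial derivative `∂/∂xᵢ`. -/
def pdE {n : ℕ} (i : Fin n) (f : Eu n → ℂ) : Eu n → ℂ :=
  fun x => fderiv ℝ f x (EuclideanSpace.single i 1)

/-- The list of coordinate directions attached to a multi-index `γ`. -/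
def mIdx {n : ℕ} (γ : Fin n → ℕ) : List (Fin n) :=
  (List.finRange n).foldr (fun i acc => List.replicate (γ i) i ++ acc) []

/-- The multi-index partial derivative `∂^γ`. -/
def mderivE {n : ℕ} (γ : Fin n → ℕ) (f : Eu n → ℂ) : Eu n → ℂ :=
  (mIdx γ).foldr pdE f

/-- The order `|γ|` of a multi-index. -/
def mOrd {n : ℕ} (γ : Fin n → ℕ) : ℕ := ∑ i, γ i

/-- Partial derivative `∂/∂xᵢ` of a function `F(x,y)`. -/
def pdX {n : ℕ} (i : Fin n) (f : Eu n → Eu n → ℂ) : Eu n → Eu n → ℂ :=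
  fun x y => fderiv ℝ (fun x' => f x' y) x (EuclideanSpace.single i 1)

/-- Partial derivative `∂/∂yᵢ` of a function `F(x,y)`. -/
def pdY {n : ℕ} (i : Fin n) (f : Eu n → Eu n → ℂ) : Eu n → Eu n → ℂ :=
  fun x y => fderiv ℝ (fun y' => f x y') y (EuclideanSpace.single i 1)

/-- The mixed multi-index derivative `∂_x^A ∂_y^B` of a function `F(x,y)`. -/
def mderiv2 {n : ℕ} (A B : Fin n → ℕ) (f : Eu n → Eu n → ℂ) : Eu n → Eu n → ℂ :=
  (mIdx A).foldr pdX ((mIdx B).foldr pdY f)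

open Filter Topology

section Calculus

variable {E V : Type*} [NormedAddCommGroup E] [NormedSpace ℝ E]
  [NormedAddCommGroup V] [NormedSpace ℝ V]

/-- The directional derivative of `g` in the direction `v`. -/
def dirDeriv (v : E) (g : E → V) : E → V := fun q => fderiv ℝ g q v

lemma contDiff_dirDeriv {g : E → V} (hg : ContDiff ℝ (⊤ : ℕ∞) g) (v : E) :
    ContDiff ℝ (⊤ : ℕ∞) (dirDeriv v g) :=
  (hg.fderiv_right (m := (⊤ : ℕ∞)) (by simp)).clm_apply contDiff_const

lemma norm_iteratedFDeriv_dirDeriv_le {g : E → V} (hg : ContDiff ℝ (⊤ : ℕ∞) g) (v q : E) (m : ℕ) :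
    ‖iteratedFDeriv ℝ m (dirDeriv v g) q‖ ≤ ‖v‖ * ‖iteratedFDeriv ℝ (m + 1) g q‖ := by
  rw [← norm_iteratedFDeriv_fderiv]
  exact norm_iteratedFDeriv_clm_apply_const (N := (⊤ : ℕ∞))
    (hg.fderiv_right (m := (⊤ : ℕ∞)) (by simp)).contDiffAt (by exact_mod_cast le_top)

lemma dirDeriv_comm {g : E → V} (hg : ContDiff ℝ (⊤ : ℕ∞) g) (v w : E) :
    dirDeriv v (dirDeriv w g) = dirDeriv w (dirDeriv v g) := by
  ext q
  have hd : DifferentiableAt ℝ (fderiv ℝ g) q :=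
    (hg.fderiv_right (m := (⊤ : ℕ∞)) (by simp)).differentiable (by simp) q
  have key (a b : E) : dirDeriv a (dirDeriv b g) q = fderiv ℝ (fderiv ℝ g) q a b := by
    unfold dirDeriv
    rw [fderiv_clm_apply hd (differentiableAt_const b)]
    simp
  rw [key, key]
  refine hg.contDiffAt.isSymmSndFDerivAt ?_ v w
  rw [minSmoothness_of_isRCLikeNormedField]
  exact WithTop.coe_le_coe.2 (le_top : (2 : ℕ∞) ≤ ⊤)

/-- All derivatives of `g` of order less than `k` vanish at `q`. -/
def VanishesToOrder (k : ℕ) (g : E → V) (q : E) : Prop :=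
  ∀ m < k, iteratedFDeriv ℝ m g q = 0

lemma VanishesToOrder.dirDeriv {k : ℕ} {g : E → V} {q : E} (h : VanishesToOrder (k + 1) g q)
    (hg : ContDiff ℝ (⊤ : ℕ∞) g) (v : E) : VanishesToOrder k (dirDeriv v g) q := by
  intro m hm
  have h1 := norm_iteratedFDeriv_dirDeriv_le hg v q m
  rw [h (m + 1) (by omega)] at h1
  simpa using h1

lemma VanishesToOrder.add {k : ℕ} {g₁ g₂ : E → V} {q : E} (h₁ : VanishesToOrder k g₁ q)
    (h₂ : VanishesToOrder k g₂ q) (hg₁ : ContDiff ℝ (⊤ : ℕ∞) g₁)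
    (hg₂ : ContDiff ℝ (⊤ : ℕ∞) g₂) : VanishesToOrder k (fun q => g₁ q + g₂ q) q := by
  intro m hm
  rw [fun_iteratedFDeriv_add_apply (hg₁.of_le (by exact_mod_cast le_top)).contDiffAt
    (hg₂.of_le (by exact_mod_cast le_top)).contDiffAt, h₁ m hm, h₂ m hm, add_zero]

lemma VanishesToOrder.sum {ι : Type*} {k : ℕ} {g : ι → E → V} {q : E} (s : Finset ι)
    (h : ∀ i, VanishesToOrder k (g i) q) (hg : ∀ i, ContDiff ℝ (⊤ : ℕ∞) (g i)) :
    VanishesToOrder k (fun q => ∑ i ∈ s, g i q) q := by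
  classical
  induction s using Finset.induction_on with
  | empty => intro m _; simp
  | insert a s ha ih =>
    simp only [Finset.sum_insert ha]
    exact (h a).add ih (hg a) (ContDiff.sum fun i _ => hg i)

lemma VanishesToOrder.mul_left {k : ℕ} {g l : E → ℂ} {q : E} (h : VanishesToOrder k g q)
    (hg : ContDiff ℝ (⊤ : ℕ∞) g) (hl : ContDiff ℝ (⊤ : ℕ∞) l) :
    VanishesToOrder k (fun q => l q * g q) q := by
  intro m hm
  rw [← norm_le_zero_iff]
  refine (norm_iteratedFDeriv_mul_le hl hg q (n := m) (by exact_mod_cast le_top)).trans ?_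
  refine (Finset.sum_eq_zero fun i _ => ?_).le
  rw [h (m - i) (by omega), norm_zero, mul_zero]

lemma VanishesToOrder.mul_of_eq_zero {k : ℕ} {g l : E → ℂ} {q : E} (h : VanishesToOrder k g q)
    (hg : ContDiff ℝ (⊤ : ℕ∞) g) (hl : ContDiff ℝ (⊤ : ℕ∞) l) (hlq : l q = 0) :
    VanishesToOrder (k + 1) (fun q => l q * g q) q := by
  intro m hm
  rw [← norm_le_zero_iff]
  refine (norm_iteratedFDeriv_mul_le hl hg q (n := m) (by exact_mod_cast le_top)).trans ?_
  refine (Finset.sum_eq_zero fun i _ => ?_).le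
  rcases Nat.eq_zero_or_pos i with rfl | hi
  · rw [norm_iteratedFDeriv_zero, hlq]; simp
  · rcases Nat.eq_zero_or_pos m with rfl | hm0
    · simp_all
    · rw [h (m - i) (by omega), norm_zero, mul_zero]

end Calculus

/-- Taylor's inequality on a segment, for a function vanishing to order `N` at its origin. -/
lemma VanishesToOrder.norm_le {E : Type} [NormedAddCommGroup E] [NormedSpace ℝ E]
    (N : ℕ) : ∀ {V : Type} [NormedAddCommGroup V] [NormedSpace ℝ V] {g : E → V} {q v : E} {B : ℝ},
      ContDiff ℝ (⊤ : ℕ∞) g → VanishesToOrder N g q →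
      (∀ t ∈ Set.Icc (0 : ℝ) 1, ‖iteratedFDeriv ℝ N g (q + t • v)‖ ≤ B) →
      ‖g (q + v)‖ ≤ B * ‖v‖ ^ N := by
  induction N with
  | zero =>
    intro V _ _ g q v B hg _ hB
    simpa using hB 1 (by simp)
  | succ N ih =>
    intro V _ _ g q v B hg hV hB
    have hB0 : 0 ≤ B := (norm_nonneg _).trans (hB 0 (by simp))
    have hg0 : g q = 0 := by
      have := hV 0 (by omega)
      rw [← norm_eq_zero, norm_iteratedFDeriv_zero] at this
      simpa using this
    have hd : ∀ t ∈ Set.Icc (0 : ℝ) 1, ‖fderiv ℝ g (q + t • v)‖ ≤ B * ‖v‖ ^ N := by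
      intro t ht
      have := ih (g := fderiv ℝ g) (q := q) (v := t • v) (B := B)
        (hg.fderiv_right (m := (⊤ : ℕ∞)) (by simp))
        (fun m hm => by
          rw [← norm_eq_zero, norm_iteratedFDeriv_fderiv, hV (m + 1) (by omega), norm_zero])
        (fun s hs => by
          rw [norm_iteratedFDeriv_fderiv, smul_smul]
          exact hB _ ⟨mul_nonneg hs.1 ht.1, mul_le_one₀ hs.2 ht.1 ht.2⟩)
      refine this.trans ?_
      gcongr
      rw [norm_smul, Real.norm_of_nonneg ht.1]
      exact mul_le_of_le_one_left (norm_nonneg _) ht.2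
    have hseg : ∀ z ∈ segment ℝ q (q + v), ‖fderiv ℝ g z‖ ≤ B * ‖v‖ ^ N := by
      intro z hz
      rw [segment_eq_image'] at hz
      obtain ⟨t, ht, rfl⟩ := hz
      simpa using hd t ht
    have := (convex_segment q (q + v)).norm_image_sub_le_of_norm_fderiv_le (𝕜 := ℝ) (f := g)
      (fun z _ => hg.differentiable (by simp) z) hseg
      (left_mem_segment ℝ _ _) (right_mem_segment ℝ _ _)
    rw [hg0] at this
    simpa [pow_succ, mul_assoc] using this

section Words

variable {n : ℕ}

lemma contDiff_foldr_pdE {f : Eu n → ℂ} (hf : ContDiff ℝ (⊤ : ℕ∞) f) (L : List (Fin n)) :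
    ContDiff ℝ (⊤ : ℕ∞) (L.foldr pdE f) := by
  induction L with
  | nil => exact hf
  | cons a L ih => exact contDiff_dirDeriv ih _

lemma foldr_pdE_perm {f : Eu n → ℂ} (hf : ContDiff ℝ (⊤ : ℕ∞) f) {L L' : List (Fin n)}
    (h : L.Perm L') : L.foldr pdE f = L'.foldr pdE f := by
  induction h with
  | nil => rfl
  | cons a _ ih => simp only [List.foldr_cons, ih]
  | swap a b L => exact dirDeriv_comm (contDiff_foldr_pdE hf L) _ _
  | trans _ _ ih₁ ih₂ => exact ih₁.trans ih₂

lemma count_mIdx (γ : Fin n → ℕ) (a : Fin n) : (mIdx γ).count a = γ a := by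
  have h (l : List (Fin n)) :
      (l.foldr (fun i acc => List.replicate (γ i) i ++ acc) []).count a = l.count a * γ a := by
    induction l with
    | nil => simp
    | cons b l ih =>
      simp only [List.foldr_cons, List.count_append, ih, List.count_replicate, List.count_cons]
      by_cases hb : b = a
      · subst hb; simp; ring
      · simp [hb]
  rw [mIdx, h, List.count_eq_one_of_mem (List.nodup_finRange n) (List.mem_finRange a), one_mul]

lemma length_mIdx (γ : Fin n → ℕ) : (mIdx γ).length = mOrd γ := by
  have h (l : List (Fin n)) :
      (l.foldr (fun i acc => List.replicate (γ i) i ++ acc) []).length = (l.map γ).sum := by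
    induction l with
    | nil => simp
    | cons b l ih =>
      rw [List.foldr_cons, List.length_append, ih, List.length_replicate, List.map_cons,
        List.sum_cons]
  rw [mIdx, h, mOrd, ← List.ofFn_eq_map, List.sum_ofFn]

/-- A word derivative only depends on the number of occurrences of each letter. -/
lemma foldr_pdE_eq_mderivE {f : Eu n → ℂ} (hf : ContDiff ℝ (⊤ : ℕ∞) f) (L : List (Fin n)) :
    L.foldr pdE f = mderivE (fun i => L.count i) f :=
  foldr_pdE_perm hf (List.perm_iff_count.2 fun a => (count_mIdx (fun i => L.count i) a).symm)

lemma fderiv_eq_sum_pdE (f : Eu n → ℂ) (x : Eu n) :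
    fderiv ℝ f x = ∑ j, (EuclideanSpace.proj j : Eu n →L[ℝ] ℝ).smulRight (pdE j f x) := by
  ext v
  conv_lhs => rw [← (EuclideanSpace.basisFun (Fin n) ℝ).sum_repr v]
  simp [pdE]

lemma norm_iteratedFDeriv_le_of_words (m : ℕ) : ∀ {f : Eu n → ℂ} {x : Eu n} {K : ℝ},
    ContDiff ℝ (⊤ : ℕ∞) f → (∀ L : List (Fin n), L.length = m → ‖L.foldr pdE f x‖ ≤ K) →
    ‖iteratedFDeriv ℝ m f x‖ ≤ (n : ℝ) ^ m * K := by
  induction m with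
  | zero =>
    intro f x K _ h
    simpa using h [] rfl
  | succ m ih =>
    intro f x K hf h
    have hs (j : Fin n) : ContDiff ℝ (⊤ : ℕ∞) (pdE j f) := contDiff_dirDeriv hf _
    let T (j : Fin n) : ℂ →L[ℝ] (Eu n →L[ℝ] ℂ) :=
      ContinuousLinearMap.smulRightL ℝ (Eu n) ℂ (EuclideanSpace.proj j)
    have hT (j : Fin n) : ‖T j‖ ≤ 1 := by
      rw [ContinuousLinearMap.norm_smulRightL]
      refine ContinuousLinearMap.opNorm_le_bound _ zero_le_one fun v => ?_
      rw [one_mul]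
      exact PiLp.norm_apply_le v j
    have hfd : fderiv ℝ f = fun y => ∑ j, (T j ∘ pdE j f) y := by
      ext1 y
      exact fderiv_eq_sum_pdE f y
    rw [← norm_iteratedFDeriv_fderiv, hfd, iteratedFDeriv_fun_sum_apply
      (fun j _ => (((T j).contDiff.comp (hs j)).of_le (by exact_mod_cast le_top)).contDiffAt)]
    refine (norm_sum_le _ _).trans ((Finset.sum_le_sum (g := fun _ => (n : ℝ) ^ m * K)
      fun j _ => ?_).trans ?_)
    · rw [(T j).iteratedFDeriv_comp_left (hs j).contDiffAt (n := (⊤ : ℕ∞))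
        (by exact_mod_cast le_top)]
      refine ((T j).norm_compContinuousMultilinearMap_le _).trans ?_
      refine (mul_le_of_le_one_left (norm_nonneg _) (hT j)).trans (ih (hs j) fun L hL => ?_)
      simpa using h (L ++ [j]) (by simp [hL])
    · simp [pow_succ]; apply le_of_eq; ring

lemma pdX_pdY_eq_dirDeriv {F : Eu n → Eu n → ℂ}
    (hF : ContDiff ℝ (⊤ : ℕ∞) (fun q : Eu n × Eu n => F q.1 q.2)) (i : Fin n) :
    (fun q : Eu n × Eu n => pdX i F q.1 q.2) =
        dirDeriv (EuclideanSpace.single i 1, 0) (fun q : Eu n × Eu n => F q.1 q.2) ∧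
      (fun q : Eu n × Eu n => pdY i F q.1 q.2) =
        dirDeriv (0, EuclideanSpace.single i 1) (fun q : Eu n × Eu n => F q.1 q.2) := by
  have hd (q : Eu n × Eu n) := (hF.differentiable (by simp) q).hasFDerivAt
  refine ⟨?_, ?_⟩ <;> ext1 ⟨x, y⟩
  · have := (hd (x, y)).comp x (hasFDerivAt_prodMk_left (𝕜 := ℝ) x y)
    simp only [pdX, dirDeriv]
    rw [show (fun x' => F x' y) = (fun q : Eu n × Eu n => F q.1 q.2) ∘ fun x' => (x', y) from rfl,
      this.fderiv]
    simp
  · have := (hd (x, y)).comp y (hasFDerivAt_prodMk_right (𝕜 := ℝ) x y)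
    simp only [pdY, dirDeriv]
    rw [show (fun y' => F x y') = (fun q : Eu n × Eu n => F q.1 q.2) ∘ fun y' => (x, y') from rfl,
      this.fderiv]
    simp

end Words

section Symbols

variable {n : ℕ}

lemma one_le_jb (x : Eu n) : 1 ≤ jb x := by
  rw [jb, Real.one_le_sqrt]
  nlinarith [sq_nonneg ‖x‖]

lemma jb_pos (x : Eu n) : 0 < jb x := one_pos.trans_le (one_le_jb x)

lemma jb_sq (x : Eu n) : jb x ^ 2 = 1 + ‖x‖ ^ 2 := Real.sq_sqrt (by positivity)

lemma norm_le_jb (x : Eu n) : ‖x‖ ≤ jb x :=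
  Real.le_sqrt_of_sq_le (by linarith)

/-- A family of smooth functions `g l`, `l ≥ 1`, on `ℝⁿ × ℝⁿ` is a symbol of weight `w` if on the
region `l |y| ≤ 2⟨x⟩` its derivatives of order `i` are `O (w l (x, y) * (l / ⟨x⟩) ^ i)`,
uniformly in `l`. -/
def IsSymb (w : ℝ → Eu n × Eu n → ℝ) (g : ℝ → Eu n × Eu n → ℂ) : Prop :=
  (∀ l, ContDiff ℝ (⊤ : ℕ∞) (g l)) ∧ ∀ i : ℕ, ∃ C : ℝ, ∀ l : ℝ, 1 ≤ l → ∀ q : Eu n × Eu n,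
    l * ‖q.2‖ ≤ 2 * jb q.1 → ‖iteratedFDeriv ℝ i (g l) q‖ ≤ C * w l q * (l / jb q.1) ^ i

lemma IsSymb.mul {w₁ w₂ : ℝ → Eu n × Eu n → ℝ} {g₁ g₂ : ℝ → Eu n × Eu n → ℂ}
    (h₁ : IsSymb w₁ g₁) (h₂ : IsSymb w₂ g₂) :
    IsSymb (fun l q => w₁ l q * w₂ l q) (fun l q => g₁ l q * g₂ l q) := by
  refine ⟨fun l => (h₁.1 l).mul (h₂.1 l), fun i => ?_⟩
  choose C₁ hC₁ using h₁.2
  choose C₂ hC₂ using h₂.2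
  refine ⟨∑ k ∈ Finset.range (i + 1), (i.choose k : ℝ) * C₁ k * C₂ (i - k), fun l hl q hq => ?_⟩
  refine (norm_iteratedFDeriv_mul_le (h₁.1 l) (h₂.1 l) q (n := i)
    (by exact_mod_cast le_top)).trans ?_
  rw [Finset.sum_mul, Finset.sum_mul]
  refine Finset.sum_le_sum fun k hk => ?_
  have hk : k ≤ i := Nat.lt_succ_iff.1 (Finset.mem_range.1 hk)
  have e₁ := hC₁ k l hl q hq
  have e₂ := hC₂ (i - k) l hl q hq
  calc (i.choose k : ℝ) * ‖iteratedFDeriv ℝ k (g₁ l) q‖ * ‖iteratedFDeriv ℝ (i - k) (g₂ l) q‖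
      ≤ i.choose k * (C₁ k * w₁ l q * (l / jb q.1) ^ k)
          * (C₂ (i - k) * w₂ l q * (l / jb q.1) ^ (i - k)) := by
        refine mul_le_mul (by gcongr) e₂ (norm_nonneg _) ?_
        exact mul_nonneg (by positivity) ((norm_nonneg _).trans e₁)
    _ = _ := by
        rw [← pow_mul_pow_sub (l / jb q.1) hk]; ring

lemma IsSymb.add {w : ℝ → Eu n × Eu n → ℝ} {g₁ g₂ : ℝ → Eu n × Eu n → ℂ}
    (h₁ : IsSymb w g₁) (h₂ : IsSymb w g₂) : IsSymb w (fun l q => g₁ l q + g₂ l q) := by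
  refine ⟨fun l => (h₁.1 l).add (h₂.1 l), fun i => ?_⟩
  obtain ⟨C₁, hC₁⟩ := h₁.2 i
  obtain ⟨C₂, hC₂⟩ := h₂.2 i
  refine ⟨C₁ + C₂, fun l hl q hq => ?_⟩
  rw [fun_iteratedFDeriv_add_apply ((h₁.1 l).of_le (by exact_mod_cast le_top)).contDiffAt
    ((h₂.1 l).of_le (by exact_mod_cast le_top)).contDiffAt]
  refine (norm_add_le _ _).trans ((add_le_add (hC₁ l hl q hq) (hC₂ l hl q hq)).trans_eq ?_)
  ring

lemma IsSymb.const {w : ℝ → Eu n × Eu n → ℝ} {c : ℝ → ℂ}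
    (h : ∀ l, 1 ≤ l → ∀ q, ‖c l‖ ≤ w l q) : IsSymb w (fun l _ => c l) := by
  refine ⟨fun l => contDiff_const, fun i => ⟨1, fun l hl q _ => ?_⟩⟩
  have hj := jb_pos q.1
  have hw := (norm_nonneg _).trans (h l hl q)
  rcases Nat.eq_zero_or_pos i with rfl | hi
  · simpa using h l hl q
  · rw [iteratedFDeriv_const_of_ne hi.ne']
    simp only [Pi.zero_apply, norm_zero]
    positivity

lemma IsSymb.sum {ι : Type*} {w : ℝ → Eu n × Eu n → ℝ} {g : ι → ℝ → Eu n × Eu n → ℂ}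
    (s : Finset ι) (hw : ∀ l, 1 ≤ l → ∀ q, 0 ≤ w l q) (h : ∀ i, IsSymb w (g i)) :
    IsSymb w (fun l q => ∑ i ∈ s, g i l q) := by
  classical
  induction s using Finset.induction_on with
  | empty => simpa using IsSymb.const (c := fun _ => 0) (by simpa using hw)
  | insert a s ha ih =>
    simp only [Finset.sum_insert ha]
    exact (h a).add ih

lemma IsSymb.clm {w : ℝ → Eu n × Eu n → ℝ} (T : Eu n × Eu n →L[ℝ] ℂ)
    (h0 : ∀ l, 1 ≤ l → ∀ q : Eu n × Eu n, l * ‖q.2‖ ≤ 2 * jb q.1 → ‖T q‖ ≤ 2 * w l q)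
    (h1 : ∀ l, 1 ≤ l → ∀ q, jb q.1 ≤ w l q * l) : IsSymb w (fun _ q => T q) := by
  refine ⟨fun _ => T.contDiff, fun i => ⟨2 + ‖T‖, fun l hl q hq => ?_⟩⟩
  have hj := jb_pos q.1
  have hl0 : 0 < l := one_pos.trans_le hl
  have hw : 0 ≤ w l q := nonneg_of_mul_nonneg_left (hj.le.trans (h1 l hl q)) hl0
  match i with
  | 0 =>
    rw [norm_iteratedFDeriv_zero, pow_zero, mul_one]
    nlinarith [h0 l hl q hq, mul_nonneg (norm_nonneg T) hw]
  | 1 =>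
    rw [norm_iteratedFDeriv_one, T.fderiv, pow_one]
    have : 1 ≤ w l q * (l / jb q.1) := by
      rw [← mul_div_assoc, one_le_div hj]
      exact h1 l hl q
    nlinarith [norm_nonneg T]
  | k + 2 =>
    rw [← norm_iteratedFDeriv_fderiv, show fderiv ℝ (fun q => T q) = fun _ => T from
      funext fun _ => T.fderiv, iteratedFDeriv_const_of_ne (by omega)]
    simp only [Pi.zero_apply, norm_zero]
    positivity

/-- Post-composition with a smooth function, in a form normalised by the weight. -/
lemma IsSymb.comp {w : ℝ → Eu n × Eu n → ℝ} {u : ℝ → Eu n × Eu n → ℂ} (hu : IsSymb w u)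
    (hw : ∀ l, 1 ≤ l → ∀ q, 0 < w l q) {t : Set ℂ} (ht : IsOpen t)
    (hut : ∀ l q, u l q ∈ t) (hts : ∀ z ∈ t, ∀ r : ℝ, 0 < r → (r : ℂ) * z ∈ t) {φ : ℂ → ℂ}
    (hφ : ContDiffOn ℝ (⊤ : ℕ∞) φ t) (i : ℕ) {B : ℝ}
    (hB : ∀ k ≤ i, ∀ l, 1 ≤ l → ∀ q : Eu n × Eu n, l * ‖q.2‖ ≤ 2 * jb q.1 →
      ‖iteratedFDerivWithin ℝ k φ t (((w l q)⁻¹ : ℝ) * u l q)‖ ≤ B) :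
    ∃ C : ℝ, ∀ l : ℝ, 1 ≤ l → ∀ q : Eu n × Eu n, l * ‖q.2‖ ≤ 2 * jb q.1 →
      ‖iteratedFDeriv ℝ i (fun q' => φ (((w l q)⁻¹ : ℝ) * u l q')) q‖ ≤
        C * (l / jb q.1) ^ i := by
  choose C hC using hu.2
  let K : ℝ := 1 + ∑ k ∈ Finset.range (i + 1), |C k|
  have hK1 : 1 ≤ K := le_add_of_nonneg_right (Finset.sum_nonneg fun _ _ => abs_nonneg _)
  refine ⟨i.factorial * B * K ^ i, fun l hl q hq => ?_⟩
  have hj := jb_pos q.1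
  have hl0 : 0 < l := one_pos.trans_le hl
  have hwq := hw l hl q
  have hsm : ContDiff ℝ (⊤ : ℕ∞) (fun q' => (((w l q)⁻¹ : ℝ) : ℂ) * u l q') :=
    contDiff_const.mul (hu.1 l)
  have := norm_iteratedFDeriv_comp_le' (𝕜 := ℝ) (g := φ) (n := i) (N := (⊤ : ℕ∞))
    (f := fun q' => (((w l q)⁻¹ : ℝ) : ℂ) * u l q') (t := t)
    (by rintro _ ⟨q', rfl⟩; exact hts _ (hut l q') _ (inv_pos.2 hwq)) ht.uniqueDiffOn hφ
    hsm (by exact_mod_cast le_top) q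
    (C := B) (D := K * (l / jb q.1)) (fun k hk => hB k hk l hl q hq) ?_
  · rw [mul_pow, ← mul_assoc] at this
    exact this
  · intro k hk1 hk
    have e : (fun q' => (((w l q)⁻¹ : ℝ) : ℂ) * u l q') = fun q' => (w l q)⁻¹ • u l q' := by
      ext; simp
    rw [e, iteratedFDeriv_const_smul_apply'
      ((hu.1 l).of_le (by exact_mod_cast le_top)).contDiffAt, norm_smul,
      Real.norm_of_nonneg (by positivity), mul_pow]
    have hCk : C k ≤ K ^ k := by
      refine (le_abs_self _).trans ((Finset.single_le_sum (f := fun k => |C k|)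
        (fun _ _ => abs_nonneg _) (Finset.mem_range.2 (Nat.lt_succ_of_le hk))).trans ?_)
      exact (by simp [K] : _ ≤ K).trans (le_self_pow₀ hK1 (by omega))
    calc (w l q)⁻¹ * ‖iteratedFDeriv ℝ k (u l) q‖
        ≤ (w l q)⁻¹ * (C k * w l q * (l / jb q.1) ^ k) := by gcongr; exact hC k l hl q hq
      _ = C k * (l / jb q.1) ^ k := by field_simp
      _ ≤ _ := by gcongr

/-- The coordinate `x_j` on `ℝⁿ × ℝⁿ`, with complex values. -/
def coordX (j : Fin n) : Eu n × Eu n →L[ℝ] ℂ :=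
  Complex.ofRealCLM ∘L (EuclideanSpace.proj j : Eu n →L[ℝ] ℝ) ∘L ContinuousLinearMap.fst ℝ _ _

/-- The coordinate `y_j` on `ℝⁿ × ℝⁿ`, with complex values. -/
def coordY (j : Fin n) : Eu n × Eu n →L[ℝ] ℂ :=
  Complex.ofRealCLM ∘L (EuclideanSpace.proj j : Eu n →L[ℝ] ℝ) ∘L ContinuousLinearMap.snd ℝ _ _

@[simp] lemma coordX_apply (j : Fin n) (q : Eu n × Eu n) : coordX j q = (q.1 j : ℂ) := rfl

@[simp] lemma coordY_apply (j : Fin n) (q : Eu n × Eu n) : coordY j q = (q.2 j : ℂ) := rfl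

lemma isSymb_coordX (j : Fin n) : IsSymb (fun _ q => jb q.1) (fun _ q => coordX (n := n) j q) := by
  refine IsSymb.clm _ (fun l hl q _ => ?_) fun l hl q => ?_
  · have h1 := (PiLp.norm_apply_le q.1 j).trans (norm_le_jb q.1)
    rw [coordX_apply, Complex.norm_real]
    linarith [jb_pos q.1]
  · exact le_mul_of_one_le_right (jb_pos q.1).le hl

lemma isSymb_coordY (j : Fin n) :
    IsSymb (fun l q => jb q.1 / l) (fun _ q => coordY (n := n) j q) := by
  refine IsSymb.clm _ (fun l hl q hq => ?_) fun l hl q => ?_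
  · have hl0 : 0 < l := one_pos.trans_le hl
    have h1 := PiLp.norm_apply_le q.2 j
    rw [coordY_apply, Complex.norm_real, ← mul_div_assoc, le_div_iff₀ hl0]
    nlinarith
  · rw [div_mul_cancel₀ _ (by positivity)]

/-- `⟨x⟩²` as a complex-valued function on `ℝⁿ × ℝⁿ`. -/
def jbSq (q : Eu n × Eu n) : ℂ := 1 + ∑ j, coordX j q * coordX j q

lemma jbSq_eq (q : Eu n × Eu n) : jbSq q = ((jb q.1 ^ 2 : ℝ) : ℂ) := by
  rw [jb_sq, EuclideanSpace.norm_sq_eq, jbSq]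
  simp [sq]

lemma sum_coordY_eq (q : Eu n × Eu n) :
    ∑ j, coordY j q * coordY j q = ((‖q.2‖ ^ 2 : ℝ) : ℂ) := by
  rw [EuclideanSpace.norm_sq_eq]
  simp [sq]

lemma isSymb_jbSq : IsSymb (fun _ q => jb q.1 * jb q.1) (fun _ => jbSq (n := n)) :=
  (IsSymb.const (c := fun _ => 1) fun l _ q => by
      rw [norm_one]; nlinarith [one_le_jb q.1]).add
    (IsSymb.sum _ (fun l _ q => mul_self_nonneg _) fun j => (isSymb_coordX j).mul (isSymb_coordX j))

lemma isSymb_inv_jbSq :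
    IsSymb (fun _ q => (jb q.1 * jb q.1)⁻¹) (fun _ q => (jbSq (n := n) q)⁻¹) := by
  have hne (q : Eu n × Eu n) : jbSq q ≠ 0 := by
    rw [jbSq_eq]
    exact_mod_cast (pow_pos (jb_pos q.1) 2).ne'
  refine ⟨fun l => (isSymb_jbSq.1 l).inv hne, fun i => ?_⟩
  obtain ⟨C, hC⟩ := (isSymb_jbSq (n := n)).comp (fun _ _ q => mul_pos (jb_pos q.1) (jb_pos q.1))
    (t := {0}ᶜ) isOpen_compl_singleton (fun _ q => hne q)
    (fun z hz r hr => mul_ne_zero (by exact_mod_cast hr.ne') hz)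
    (φ := Inv.inv) (contDiffOn_inv ℝ) i
    (B := ∑ k ∈ Finset.range (i + 1), ‖iteratedFDerivWithin ℝ k (Inv.inv : ℂ → ℂ) {0}ᶜ 1‖)
    (fun k hk l hl q hq => by
      have : (((jb q.1 * jb q.1)⁻¹ : ℝ) : ℂ) * jbSq q = 1 := by
        rw [jbSq_eq, ← sq, ← Complex.ofReal_mul, inv_mul_cancel₀ (pow_pos (jb_pos q.1) 2).ne',
          Complex.ofReal_one]
      rw [this]
      exact Finset.single_le_sum (f := fun k => ‖iteratedFDerivWithin ℝ k (Inv.inv : ℂ → ℂ) {0}ᶜ 1‖)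
        (fun _ _ => norm_nonneg _) (Finset.mem_range.2 (Nat.lt_succ_of_le hk)))
  refine ⟨C, fun l hl q hq => ?_⟩
  have hj := jb_pos q.1
  have e₀ {r : ℝ} (hr : r ≠ 0) (z : ℂ) : z⁻¹ = r⁻¹ • (((r⁻¹ : ℝ) : ℂ) * z)⁻¹ := by
    have h1 : (r : ℂ) ≠ 0 := by exact_mod_cast hr
    rw [Complex.real_smul, mul_inv, Complex.ofReal_inv, inv_inv, ← mul_assoc, inv_mul_cancel₀ h1,
      one_mul]
  have e : (fun q' => (jbSq q')⁻¹) = fun q' : Eu n × Eu n => (jb q.1 * jb q.1)⁻¹ •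
      (((((jb q.1 * jb q.1)⁻¹ : ℝ) : ℂ)) * jbSq q')⁻¹ := by
    ext q'
    exact e₀ (mul_pos hj hj).ne' _
  have hsm : ContDiff ℝ (⊤ : ℕ∞) fun q' : Eu n × Eu n =>
      (((((jb q.1 * jb q.1)⁻¹ : ℝ) : ℂ)) * jbSq q')⁻¹ :=
    (contDiff_const.mul (isSymb_jbSq.1 l)).inv fun q' => mul_ne_zero
      (by exact_mod_cast (inv_pos.2 (mul_pos hj hj)).ne') (hne q')
  rw [e, iteratedFDeriv_const_smul_apply' (hsm.of_le (by exact_mod_cast le_top)).contDiffAt,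
    norm_smul, Real.norm_of_nonneg (by positivity), mul_comm C, mul_assoc]
  exact mul_le_mul_of_nonneg_left (hC l hl q hq) (by positivity)

/-- A bump function on `ℂ` equal to `1` on the unit disc and supported in the disc of radius `4`. -/
def bump : ContDiffBump (0 : ℂ) := ⟨1, 4, one_pos, by norm_num⟩

/-- The function `l² |y|² / ⟨x⟩²`. -/
def ratio (l : ℝ) (q : Eu n × Eu n) : ℂ :=
  (l : ℂ) ^ 2 * ((∑ j, coordY j q * coordY j q) * (jbSq q)⁻¹)

lemma ratio_eq (l : ℝ) (q : Eu n × Eu n) : ratio l q = (((l * ‖q.2‖ / jb q.1) ^ 2 : ℝ) : ℂ) := by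
  rw [ratio, sum_coordY_eq, jbSq_eq]
  push_cast
  ring

lemma isSymb_ratio : IsSymb (fun _ _ => 1) (ratio (n := n)) := by
  have h := (IsSymb.const (n := n) (w := fun l _ => l ^ 2) (c := fun l => (l : ℂ) ^ 2)
    (fun l hl q => by simp)).mul ((IsSymb.sum Finset.univ (fun l hl q => mul_self_nonneg _)
      fun j => (isSymb_coordY j).mul (isSymb_coordY j)).mul isSymb_inv_jbSq)
  refine ⟨h.1, fun i => ?_⟩
  obtain ⟨C, hC⟩ := h.2 i
  refine ⟨C, fun l hl q hq => (hC l hl q hq).trans_eq ?_⟩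
  have := (jb_pos q.1).ne'
  have : l ≠ 0 := by positivity
  field_simp

/-- The cutoff to the region `l |y| ≤ 2⟨x⟩`, equal to `1` where `l |y| ≤ ⟨x⟩`. -/
def cutoff (l : ℝ) (q : Eu n × Eu n) : ℂ := (bump (ratio l q) : ℝ)

lemma isSymb_cutoff : IsSymb (fun _ _ => 1) (cutoff (n := n)) := by
  have hb : ContDiff ℝ (⊤ : ℕ∞) fun z : ℂ => ((bump z : ℝ) : ℂ) :=
    Complex.ofRealCLM.contDiff.comp bump.contDiff
  refine ⟨fun l => hb.comp (isSymb_ratio.1 l), fun i => ?_⟩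
  have hbd (k : ℕ) : ∃ B, ∀ z, ‖iteratedFDeriv ℝ k (fun z : ℂ => ((bump z : ℝ) : ℂ)) z‖ ≤ B := by
    have hc : HasCompactSupport fun z : ℂ => ((bump z : ℝ) : ℂ) :=
      bump.hasCompactSupport.comp_left (g := fun r : ℝ => (r : ℂ)) Complex.ofReal_zero
    exact (hc.iteratedFDeriv k).exists_bound_of_continuous
      (hb.continuous_iteratedFDeriv (by exact_mod_cast le_top))
  choose B hB using hbd
  obtain ⟨C, hC⟩ := (isSymb_ratio (n := n)).comp (fun _ _ _ => one_pos) (t := Set.univ)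
    isOpen_univ (fun _ _ => trivial) (fun _ _ _ _ => trivial) hb.contDiffOn i
    (B := ∑ k ∈ Finset.range (i + 1), |B k|)
    (fun k hk l hl q hq => by
      rw [iteratedFDerivWithin_univ]
      exact ((hB k _).trans (le_abs_self _)).trans (Finset.single_le_sum (f := fun k => |B k|)
        (fun _ _ => abs_nonneg _) (Finset.mem_range.2 (Nat.lt_succ_of_le hk))))
  refine ⟨C, fun l hl q hq => ?_⟩
  change ‖iteratedFDeriv ℝ i (fun q' => ((bump (ratio l q') : ℝ) : ℂ)) q‖ ≤ _
  simpa using hC l hl q hq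

lemma cutoff_eq_one {l : ℝ} {q : Eu n × Eu n} (hl : 0 ≤ l) (h : l * ‖q.2‖ ≤ jb q.1) :
    cutoff l q = 1 := by
  have hj := jb_pos q.1
  rw [cutoff, bump.one_of_mem_closedBall, Complex.ofReal_one]
  rw [mem_closedBall_zero_iff, ratio_eq, Complex.norm_real, Real.norm_of_nonneg (by positivity)]
  exact pow_le_one₀ (by positivity) ((div_le_one hj).2 h)

lemma cutoff_eq_zero {l : ℝ} {q : Eu n × Eu n} (h : 2 * jb q.1 ≤ l * ‖q.2‖) :
    cutoff l q = 0 := by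
  have hj := jb_pos q.1
  rw [cutoff, bump.zero_of_le_dist, Complex.ofReal_zero]
  rw [dist_zero_right, ratio_eq, Complex.norm_real, Real.norm_of_nonneg (by positivity)]
  have : 2 ≤ l * ‖q.2‖ / jb q.1 := (le_div_iff₀ hj).2 h
  change (4 : ℝ) ≤ _
  nlinarith

end Symbols

section TaylorTerms

variable {n : ℕ}

/-- The `k`-th order homogeneous form `∑ y_{j₁} ⋯ y_{jₖ} ∂_{j₁} ⋯ ∂_{jₖ} h (x)`. -/
def taylorForm : ℕ → (Eu n → ℂ) → Eu n × Eu n → ℂ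
  | 0, h => fun q => h q.1
  | k + 1, h => fun q => ∑ j, coordY j q * taylorForm k (pdE j h) q

lemma contDiff_pdE {h : Eu n → ℂ} (hh : ContDiff ℝ (⊤ : ℕ∞) h) (j : Fin n) :
    ContDiff ℝ (⊤ : ℕ∞) (pdE j h) := contDiff_dirDeriv hh _

lemma contDiff_taylorForm (k : ℕ) : ∀ {h : Eu n → ℂ}, ContDiff ℝ (⊤ : ℕ∞) h →
    ContDiff ℝ (⊤ : ℕ∞) (taylorForm k h) := by
  induction k with
  | zero => intro h hh; exact hh.comp contDiff_fst
  | succ k ih =>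
    intro h hh
    exact ContDiff.sum fun j _ => (coordY j).contDiff.mul (ih (contDiff_pdE hh j))

lemma vanishesToOrder_taylorForm (k : ℕ) : ∀ {h : Eu n → ℂ}, ContDiff ℝ (⊤ : ℕ∞) h → ∀ x,
    VanishesToOrder k (taylorForm k h) (x, 0) := by
  induction k with
  | zero => intro h hh x m hm; omega
  | succ k ih =>
    intro h hh x
    exact VanishesToOrder.sum _
      (fun j => (ih (contDiff_pdE hh j) x).mul_of_eq_zero (contDiff_taylorForm k (contDiff_pdE hh j))
        (coordY j).contDiff (by simp))
      fun j => (coordY j).contDiff.mul (contDiff_taylorForm k (contDiff_pdE hh j))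

lemma dirDeriv_sum_coordY_mul (v : Eu n × Eu n) {g : Fin n → Eu n × Eu n → ℂ}
    (hg : ∀ j, ContDiff ℝ (⊤ : ℕ∞) (g j)) (q : Eu n × Eu n) :
    dirDeriv v (fun q => ∑ j, coordY j q * g j q) q =
      ∑ j, (coordY j q * dirDeriv v (g j) q + coordY j v * g j q) := by
  have hd (j : Fin n) : DifferentiableAt ℝ (g j) q := (hg j).differentiable (by simp) q
  unfold dirDeriv
  have hm (j : Fin n) : DifferentiableAt ℝ (fun q => coordY j q * g j q) q :=
    (coordY j).differentiableAt.mul (hd j)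
  rw [fderiv_fun_sum fun j _ => hm j, sum_apply]
  refine Finset.sum_congr rfl fun j _ => ?_
  rw [fderiv_fun_mul (coordY j).differentiableAt (hd j)]
  simp [mul_comm]

lemma dirDeriv_fst_taylorForm (k : ℕ) : ∀ {h : Eu n → ℂ}, ContDiff ℝ (⊤ : ℕ∞) h → ∀ i q,
    dirDeriv (EuclideanSpace.single i 1, 0) (taylorForm k h) q = taylorForm k (pdE i h) q := by
  induction k with
  | zero =>
    intro h hh i q
    have hd : HasFDerivAt h (fderiv ℝ h q.1) q.1 := (hh.differentiable (by simp) q.1).hasFDerivAt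
    change fderiv ℝ (fun q : Eu n × Eu n => h q.1) q _ = fderiv ℝ h q.1 _
    rw [show (fun q : Eu n × Eu n => h q.1) = h ∘ Prod.fst from rfl,
      (hd.comp q hasFDerivAt_fst).fderiv]
    simp
  | succ k ih =>
    intro h hh i q
    simp only [taylorForm]
    rw [dirDeriv_sum_coordY_mul _ fun j => contDiff_taylorForm k (contDiff_pdE hh j)]
    refine Finset.sum_congr rfl fun j _ => ?_
    rw [ih (contDiff_pdE hh j), show pdE i (pdE j h) = pdE j (pdE i h) from dirDeriv_comm hh _ _]
    simp

lemma dirDeriv_snd_taylorForm_zero (h : Eu n → ℂ) (v : Eu n) (q) :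
    dirDeriv (0, v) (taylorForm 0 h) q = 0 := by
  change fderiv ℝ (fun q : Eu n × Eu n => h q.1) q _ = 0
  by_cases hd : DifferentiableAt ℝ (fun q : Eu n × Eu n => h q.1) q
  · have h1 := hd.hasFDerivAt.comp_hasDerivAt_of_eq (0 : ℝ)
      (((hasDerivAt_id (0 : ℝ)).smul_const ((0, v) : Eu n × Eu n)).const_add q) (by simp)
    have h2 : ((fun q : Eu n × Eu n => h q.1) ∘ fun t : ℝ => q + id t • (0, v)) =
        fun _ => h q.1 := by ext; simp
    rw [h2] at h1
    simpa using h1.unique (hasDerivAt_const _ _)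
  · rw [fderiv_zero_of_not_differentiableAt hd]; rfl

lemma dirDeriv_snd_taylorForm_succ (k : ℕ) : ∀ {h : Eu n → ℂ}, ContDiff ℝ (⊤ : ℕ∞) h → ∀ i q,
    dirDeriv (0, EuclideanSpace.single i 1) (taylorForm (k + 1) h) q =
      (k + 1) * taylorForm k (pdE i h) q := by
  have hs (g : Fin n → ℂ) (i : Fin n) :
      ∑ j, coordY j ((0, EuclideanSpace.single i 1) : Eu n × Eu n) * g j = g i := by
    rw [Finset.sum_eq_single i (fun j _ hj => by simp [hj]) (by simp)]
    simp
  induction k with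
  | zero =>
    intro h hh i q
    change dirDeriv _ (fun q => ∑ j, coordY j q * taylorForm 0 (pdE j h) q) q = _
    rw [dirDeriv_sum_coordY_mul _ fun j => contDiff_taylorForm 0 (contDiff_pdE hh j),
      Finset.sum_add_distrib, hs]
    simp [dirDeriv_snd_taylorForm_zero]
  | succ k ih =>
    intro h hh i q
    change dirDeriv _ (fun q => ∑ j, coordY j q * taylorForm (k + 1) (pdE j h) q) q = _
    rw [dirDeriv_sum_coordY_mul _
      fun j => contDiff_taylorForm (k + 1) (contDiff_pdE hh j), Finset.sum_add_distrib, hs]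
    have : ∑ j, coordY j q *
        dirDeriv (0, EuclideanSpace.single i 1) (taylorForm (k + 1) (pdE j h)) q =
        (k + 1) * taylorForm (k + 1) (pdE i h) q := by
      rw [taylorForm, Finset.mul_sum]
      refine Finset.sum_congr rfl fun j _ => ?_
      rw [ih (contDiff_pdE hh j), show pdE i (pdE j h) = pdE j (pdE i h) from dirDeriv_comm hh _ _]
      ring
    rw [this]
    push_cast
    ring

/-- The formal Taylor polynomial of `f (x + i y)` in `y`. -/
def taylorPoly (N : ℕ) (f : Eu n → ℂ) (q : Eu n × Eu n) : ℂ :=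
  ∑ k ∈ Finset.range (N + 1), (Complex.I ^ k / k.factorial) * taylorForm k f q

/-- Twice the operator `∂̄_j`. -/
def dbar (j : Fin n) (g : Eu n × Eu n → ℂ) (q : Eu n × Eu n) : ℂ :=
  dirDeriv (EuclideanSpace.single j 1, 0) g q +
    Complex.I * dirDeriv (0, EuclideanSpace.single j 1) g q

lemma contDiff_dbar {g : Eu n × Eu n → ℂ} (hg : ContDiff ℝ (⊤ : ℕ∞) g) (j : Fin n) :
    ContDiff ℝ (⊤ : ℕ∞) (dbar j g) :=
  (contDiff_dirDeriv hg _).add (contDiff_const.mul (contDiff_dirDeriv hg _))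

lemma VanishesToOrder.dbar {k : ℕ} {g : Eu n × Eu n → ℂ} {q : Eu n × Eu n}
    (h : VanishesToOrder (k + 1) g q) (hg : ContDiff ℝ (⊤ : ℕ∞) g) (j : Fin n) :
    VanishesToOrder k (dbar j g) q :=
  (h.dirDeriv hg _).add ((h.dirDeriv hg _).mul_left (contDiff_dirDeriv hg _) contDiff_const)
    (contDiff_dirDeriv hg _) (contDiff_const.mul (contDiff_dirDeriv hg _))

lemma norm_iteratedFDeriv_dbar_le {g : Eu n × Eu n → ℂ} (hg : ContDiff ℝ (⊤ : ℕ∞) g) (j : Fin n)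
    (m : ℕ) (q : Eu n × Eu n) :
    ‖iteratedFDeriv ℝ m (dbar j g) q‖ ≤ 2 * ‖iteratedFDeriv ℝ (m + 1) g q‖ := by
  have h1 := contDiff_dirDeriv hg ((EuclideanSpace.single j 1, 0) : Eu n × Eu n)
  have h2 := contDiff_dirDeriv hg ((0, EuclideanSpace.single j 1) : Eu n × Eu n)
  have e : dbar j g = fun q => dirDeriv (EuclideanSpace.single j 1, 0) g q +
    Complex.I • dirDeriv (0, EuclideanSpace.single j 1) g q := rfl
  rw [e, fun_iteratedFDeriv_add_apply (h1.of_le (by exact_mod_cast le_top)).contDiffAt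
    ((h2.const_smul Complex.I).of_le (by exact_mod_cast le_top)).contDiffAt]
  refine (norm_add_le _ _).trans ?_
  rw [iteratedFDeriv_const_smul_apply' (h2.of_le (by exact_mod_cast le_top)).contDiffAt, norm_smul,
    Complex.norm_I, one_mul]
  have e1 := norm_iteratedFDeriv_dirDeriv_le hg
    ((EuclideanSpace.single j 1, 0) : Eu n × Eu n) q m
  have e2 := norm_iteratedFDeriv_dirDeriv_le hg
    ((0, EuclideanSpace.single j 1) : Eu n × Eu n) q m
  simp only [Prod.norm_def, PiLp.norm_single, norm_one, norm_zero, zero_le_one,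
    sup_of_le_left, sup_of_le_right, one_mul] at e1 e2
  linarith

lemma dbar_add {g₁ g₂ : Eu n × Eu n → ℂ} (h₁ : ContDiff ℝ (⊤ : ℕ∞) g₁)
    (h₂ : ContDiff ℝ (⊤ : ℕ∞) g₂) (j : Fin n) :
    dbar j (fun q => g₁ q + g₂ q) = fun q => dbar j g₁ q + dbar j g₂ q := by
  ext q
  simp only [dbar, dirDeriv]
  rw [fderiv_fun_add (h₁.differentiable (by simp) q) (h₂.differentiable (by simp) q)]
  simp only [add_apply]
  ring

lemma contDiff_taylorPoly (N : ℕ) {f : Eu n → ℂ} (hf : ContDiff ℝ (⊤ : ℕ∞) f) :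
    ContDiff ℝ (⊤ : ℕ∞) (taylorPoly N f) :=
  ContDiff.sum fun k _ => contDiff_const.mul (contDiff_taylorForm k hf)

lemma dbar_const_mul {g : Eu n × Eu n → ℂ} (h : ContDiff ℝ (⊤ : ℕ∞) g) (c : ℂ) (j : Fin n) :
    dbar j (fun q => c * g q) = fun q => c * dbar j g q := by
  ext q
  simp only [dbar, dirDeriv]
  rw [fderiv_const_mul (h.differentiable (by simp) q)]
  simp only [smul_apply, smul_eq_mul]
  ring

/-- The sum defining `∂̄_j` of the Taylor polynomial telescopes. -/
lemma dbar_taylorPoly (N : ℕ) {f : Eu n → ℂ} (hf : ContDiff ℝ (⊤ : ℕ∞) f) (j : Fin n) :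
    dbar j (taylorPoly N f) =
      fun q => (Complex.I ^ N / N.factorial) * taylorForm N (pdE j f) q := by
  have hform (k : ℕ) : dbar j (fun q => (Complex.I ^ k / k.factorial) * taylorForm k f q) = fun q =>
      (Complex.I ^ k / k.factorial) * dbar j (taylorForm k f) q :=
    dbar_const_mul (contDiff_taylorForm k hf) _ j
  induction N with
  | zero =>
    have e : taylorPoly 0 f =
      fun q => (Complex.I ^ 0 / (Nat.factorial 0 : ℂ)) * taylorForm 0 f q := by
      ext q; simp [taylorPoly]
    rw [e, hform]
    ext q
    simp only [dbar, dirDeriv_fst_taylorForm 0 hf, dirDeriv_snd_taylorForm_zero, mul_zero, add_zero]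
  | succ N ih =>
    have e : taylorPoly (N + 1) f = fun q => taylorPoly N f q +
        (Complex.I ^ (N + 1) / ((N + 1).factorial : ℂ)) * taylorForm (N + 1) f q := by
      ext q; rw [taylorPoly, Finset.sum_range_succ]; rfl
    rw [e, dbar_add (contDiff_taylorPoly N hf)
      (contDiff_const.mul (contDiff_taylorForm (N + 1) hf)), ih, hform]
    ext q
    simp only [dbar, dirDeriv_fst_taylorForm (N + 1) hf, dirDeriv_snd_taylorForm_succ N hf,
      Nat.factorial_succ]
    have h1 : (N.factorial : ℂ) ≠ 0 := by exact_mod_cast N.factorial_ne_zero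
    have h2 : (N : ℂ) + 1 ≠ 0 := by exact_mod_cast N.succ_ne_zero
    push_cast
    field_simp
    rw [pow_succ]
    linear_combination (taylorForm N (pdE j f) q * Complex.I ^ N * (N + 1)) * Complex.I_sq

/-- Derivative bounds for a function of `x` alone, with weight `w`. -/
def XBound (w : Eu n → ℝ) (h : Eu n → ℂ) : Prop :=
  ∀ i : ℕ, ∃ C : ℝ, ∀ x, ‖iteratedFDeriv ℝ i h x‖ ≤ C * w x * (1 / jb x) ^ i

lemma XBound.pdE {w : Eu n → ℝ} {h : Eu n → ℂ} (hb : XBound w h) (hh : ContDiff ℝ (⊤ : ℕ∞) h)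
    (j : Fin n) : XBound (fun x => w x / jb x) (pdE j h) := by
  intro i
  obtain ⟨C, hC⟩ := hb (i + 1)
  refine ⟨C, fun x => ?_⟩
  have := norm_iteratedFDeriv_dirDeriv_le hh (EuclideanSpace.single j (1 : ℝ)) x i
  rw [PiLp.norm_single, norm_one, one_mul] at this
  refine this.trans ((hC x).trans_eq ?_)
  rw [pow_succ]
  ring

lemma norm_iteratedFDeriv_comp_fst_le {h : Eu n → ℂ} (hh : ContDiff ℝ (⊤ : ℕ∞) h) (i : ℕ)
    (q : Eu n × Eu n) :
    ‖iteratedFDeriv ℝ i (fun q : Eu n × Eu n => h q.1) q‖ ≤ ‖iteratedFDeriv ℝ i h q.1‖ := by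
  have := (ContinuousLinearMap.fst ℝ (Eu n) (Eu n)).iteratedFDeriv_comp_right hh q (i := i)
    (by exact_mod_cast le_top)
  change ‖iteratedFDeriv ℝ i (h ∘ ContinuousLinearMap.fst ℝ (Eu n) (Eu n)) q‖ ≤ _
  rw [this]
  refine (ContinuousMultilinearMap.norm_compContinuousLinearMap_le _ _).trans ?_
  refine mul_le_of_le_one_right (norm_nonneg _) (Finset.prod_le_one (fun _ _ => norm_nonneg _) ?_)
  exact fun _ _ => ContinuousLinearMap.norm_fst_le ℝ (Eu n) (Eu n)

lemma XBound.isSymb_taylorForm (k : ℕ) : ∀ {w : Eu n → ℝ} {h : Eu n → ℂ}, (∀ x, 0 ≤ w x) →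
    XBound w h → ContDiff ℝ (⊤ : ℕ∞) h →
    IsSymb (fun l q => w q.1 / l ^ k) (fun _ => taylorForm k h) := by
  induction k with
  | zero =>
    intro w h hw hb hh
    refine ⟨fun _ => contDiff_taylorForm 0 hh, fun i => ?_⟩
    obtain ⟨C, hC⟩ := hb i
    refine ⟨|C|, fun l hl q _ => (norm_iteratedFDeriv_comp_fst_le hh i q).trans ?_⟩
    have hj := jb_pos q.1
    refine (hC q.1).trans ?_
    simp only [pow_zero, div_one]
    have := hw q.1
    gcongr
    exact le_abs_self C
  | succ k ih =>
    intro w h hw hb hh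
    have hj (j : Fin n) := (isSymb_coordY j).mul
      (ih (fun x => div_nonneg (hw x) (jb_pos x).le) (hb.pdE hh j) (contDiff_pdE hh j))
    have hs := IsSymb.sum Finset.univ (fun l hl q => ?_) hj
    · refine ⟨hs.1, fun i => ?_⟩
      obtain ⟨C, hC⟩ := hs.2 i
      refine ⟨C, fun l hl q hq => (hC l hl q hq).trans_eq ?_⟩
      have := (jb_pos q.1).ne'
      have : l ≠ 0 := by positivity
      field_simp
      ring
    · have := jb_pos q.1
      have := hw q.1
      positivity

end TaylorTerms

section Extension

variable {n : ℕ}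

lemma norm_iteratedFDeriv_le_of_mderivE (m : ℕ) {f : Eu n → ℂ} (hf : ContDiff ℝ (⊤ : ℕ∞) f)
    {x : Eu n} {K : ℝ} (h : ∑ γ ∈ Finset.Nat.antidiagonalTuple n m, ‖mderivE γ f x‖ ≤ K) :
    ‖iteratedFDeriv ℝ m f x‖ ≤ n ^ m * K := by
  refine norm_iteratedFDeriv_le_of_words m hf fun L hL => ?_
  rw [foldr_pdE_eq_mderivE hf]
  refine (Finset.single_le_sum (f := fun γ => ‖mderivE γ f x‖) (fun _ _ => norm_nonneg _)
    (Finset.Nat.mem_antidiagonalTuple.2 ?_)).trans h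
  rw [← hL]
  simpa using Multiset.sum_count_eq_card (m := (L : Multiset (Fin n))) fun a _ => Finset.mem_univ a

lemma jb_rpow_neg_add (x : Eu n) (σ : ℝ) (m : ℕ) :
    jb x ^ (-((m : ℝ) + σ)) = jb x ^ (-σ) * (1 / jb x) ^ m := by
  rw [show -((m : ℝ) + σ) = -σ - m by ring, Real.rpow_sub_natCast (jb_pos x).ne', one_div, inv_pow,
    div_eq_mul_inv]

lemma xBound_pdE {f : Eu n → ℂ} (hf : ContDiff ℝ (⊤ : ℕ∞) f) {σ : ℝ} {A : ℕ → ℝ}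
    (hA : ∀ m, 1 ≤ m → ∀ x, ‖iteratedFDeriv ℝ m f x‖ ≤ A m * jb x ^ (-((m : ℝ) + σ))) (j : Fin n) :
    XBound (fun x => jb x ^ (-σ) / jb x) (pdE j f) := by
  intro i
  refine ⟨A (i + 1), fun x => ?_⟩
  have := norm_iteratedFDeriv_dirDeriv_le hf (EuclideanSpace.single j (1 : ℝ)) x i
  rw [PiLp.norm_single, norm_one, one_mul] at this
  refine this.trans ((hA (i + 1) (by omega) x).trans_eq ?_)
  rw [jb_rpow_neg_add, pow_succ]
  ring

/-- The `k`-th correction term of the extension, cut off at `|y| ∼ ⟨x⟩ / l`. -/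
def extTerm (f : Eu n → ℂ) (k : ℕ) (l : ℝ) (q : Eu n × Eu n) : ℂ :=
  cutoff l q * (Complex.I ^ (k + 1) / (k + 1).factorial * taylorForm (k + 1) f q)

lemma isSymb_extTerm {f : Eu n → ℂ} (hf : ContDiff ℝ (⊤ : ℕ∞) f) {σ : ℝ}
    (hb : ∀ j, XBound (fun x => jb x ^ (-σ) / jb x) (pdE j f)) (k : ℕ) :
    IsSymb (fun l q => jb q.1 ^ (-σ) / l ^ (k + 1)) (extTerm f k) := by
  have hw (x : Eu n) : 0 ≤ jb x ^ (-σ) := Real.rpow_nonneg (jb_pos x).le _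
  have h1 (j : Fin n) := (isSymb_coordY j).mul (XBound.isSymb_taylorForm k
    (fun x => div_nonneg (hw x) (jb_pos x).le) (hb j) (contDiff_pdE hf j))
  have h2 := IsSymb.sum Finset.univ (fun l hl q => by
    have := hw q.1
    have := jb_pos q.1
    positivity) h1
  have h3 := (isSymb_cutoff (n := n)).mul ((IsSymb.const (w := fun _ _ => 1)
    (c := fun _ => Complex.I ^ (k + 1) / (k + 1).factorial) fun l hl q => by
      rw [norm_div, norm_pow, Complex.norm_I, one_pow, Complex.norm_natCast]
      exact div_le_one_of_le₀ (by exact_mod_cast (k + 1).factorial_pos) (by positivity)).mul h2)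
  refine cast (congrArg (fun w => IsSymb w (extTerm f k)) ?_) h3
  ext l q
  have := (jb_pos q.1).ne'
  rw [one_mul, one_mul, div_mul_div_comm, mul_div_cancel₀ _ this, ← pow_succ']

lemma norm_iteratedFDeriv_extTerm_le {f : Eu n → ℂ} (hf : ContDiff ℝ (⊤ : ℕ∞) f) {σ : ℝ}
    (hb : ∀ j, XBound (fun x => jb x ^ (-σ) / jb x) (pdE j f)) (k i : ℕ) :
    ∃ C : ℝ, 0 ≤ C ∧ ∀ l : ℝ, 1 ≤ l → ∀ q : Eu n × Eu n, ‖iteratedFDeriv ℝ i (extTerm f k l) q‖ ≤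
      C * (jb q.1 ^ (-σ) / l ^ (k + 1)) * (l / jb q.1) ^ i := by
  obtain ⟨C, hC⟩ := (isSymb_extTerm hf hb k).2 i
  refine ⟨|C|, abs_nonneg C, fun l hl q => ?_⟩
  have hj := jb_pos q.1
  have hl0 : 0 < l := one_pos.trans_le hl
  have hw : 0 ≤ jb q.1 ^ (-σ) := Real.rpow_nonneg hj.le _
  rcases le_or_gt (l * ‖q.2‖) (2 * jb q.1) with hq | hq
  · refine (hC l hl q hq).trans ?_
    gcongr
    exact le_abs_self C
  · have hopen : IsOpen {q : Eu n × Eu n | 2 * jb q.1 < l * ‖q.2‖} := by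
      refine isOpen_lt ?_ (by fun_prop)
      unfold jb
      fun_prop
    have he : extTerm f k l =ᶠ[𝓝 q] fun _ => 0 := by
      filter_upwards [hopen.mem_nhds hq] with p hp
      rw [extTerm, cutoff_eq_zero (le_of_lt hp), zero_mul]
    rw [(he.iteratedFDeriv ℝ i).eq_of_nhds, iteratedFDeriv_fun_zero]
    simp only [Pi.zero_apply, norm_zero]
    positivity

lemma exists_scales {C : ℕ → ℕ → ℝ} (hC : ∀ k i, 0 ≤ C k i) :
    ∃ l : ℕ → ℝ, (∀ k, 1 ≤ l k) ∧ ∀ i, Summable fun k => C k i / l k ^ (k + 1) * l k ^ i := by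
  have hs (k : ℕ) : 0 ≤ ∑ i ∈ Finset.range (k + 1), C k i := Finset.sum_nonneg fun i _ => hC k i
  refine ⟨fun k => 1 + 2 ^ k * ∑ i ∈ Finset.range (k + 1), C k i, fun k => ?_, fun i => ?_⟩
  · have := hs k
    have : 0 ≤ (2 : ℝ) ^ k * ∑ i ∈ Finset.range (k + 1), C k i := by positivity
    linarith
  · refine Summable.of_norm_bounded_eventually_nat (g := fun k => (1 / 2 : ℝ) ^ k)
      summable_geometric_two ?_
    filter_upwards [eventually_ge_atTop i] with k hk
    have h0 := hs k
    have h1 : C k i ≤ ∑ i ∈ Finset.range (k + 1), C k i :=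
      Finset.single_le_sum (f := C k) (fun i _ => hC k i) (Finset.mem_range.2 (by omega))
    set l : ℝ := 1 + 2 ^ k * ∑ i ∈ Finset.range (k + 1), C k i with hl
    have hl1 : 1 ≤ l := by
      have : 0 ≤ (2 : ℝ) ^ k * ∑ i ∈ Finset.range (k + 1), C k i := by positivity
      linarith
    have hl0 : 0 < l := by linarith
    have h2 : 2 ^ k * C k i ≤ l := by
      have := mul_le_mul_of_nonneg_left h1 (pow_nonneg zero_le_two k)
      linarith
    have h3 : l ^ i ≤ l ^ k := pow_le_pow_right₀ hl1 hk
    have := hC k i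
    rw [Real.norm_of_nonneg (by positivity), div_mul_eq_mul_div, one_div, inv_pow,
      div_le_iff₀ (by positivity), inv_mul_eq_div, le_div_iff₀ (by positivity)]
    calc C k i * l ^ i * 2 ^ k = 2 ^ k * C k i * l ^ i := by ring
      _ ≤ l * l ^ k := by gcongr
      _ = l ^ (k + 1) := (pow_succ' l k).symm

/-- Borel-type construction of an almost analytic extension with symbol bounds. -/
lemma exists_almostAnalytic {f : Eu n → ℂ} (hf : ContDiff ℝ (⊤ : ℕ∞) f) {σ : ℝ}
    (hb : ∀ j, XBound (fun x => jb x ^ (-σ) / jb x) (pdE j f)) (hσ : 0 ≤ σ) :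
    ∃ G : Eu n × Eu n → ℂ, ContDiff ℝ (⊤ : ℕ∞) G ∧ (∀ x, G (x, 0) = 0) ∧
      (∀ i, ∃ C : ℝ, ∀ q, ‖iteratedFDeriv ℝ i G q‖ ≤ C * jb q.1 ^ (-((i : ℝ) + σ))) ∧
      ∀ N x j, VanishesToOrder N (dbar j fun q => f q.1 + G q) (x, 0) := by
  choose C hC0 hC using norm_iteratedFDeriv_extTerm_le hf hb
  obtain ⟨l, hl1, hl⟩ := exists_scales hC0
  have hsm (k : ℕ) : ContDiff ℝ (⊤ : ℕ∞) (extTerm f k (l k)) := (isSymb_extTerm hf hb k).1 _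
  have hbd (i k : ℕ) (q : Eu n × Eu n) : ‖iteratedFDeriv ℝ i (extTerm f k (l k)) q‖ ≤
      C k i / l k ^ (k + 1) * l k ^ i * jb q.1 ^ (-((i : ℝ) + σ)) := by
    refine (hC k i (l k) (hl1 k) q).trans_eq ?_
    rw [jb_rpow_neg_add, div_pow, div_pow, one_pow]
    ring
  have hbd' (i k : ℕ) (q : Eu n × Eu n) : ‖iteratedFDeriv ℝ i (extTerm f k (l k)) q‖ ≤
      C k i / l k ^ (k + 1) * l k ^ i := by
    have := hC0 k i
    have := hl1 k
    refine (hbd i k q).trans (mul_le_of_le_one_right (by positivity) ?_)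
    exact Real.rpow_le_one_of_one_le_of_nonpos (one_le_jb _) (neg_nonpos.2 (by positivity))
  have hder (i : ℕ) (q : Eu n × Eu n) :
      iteratedFDeriv ℝ i (fun q => ∑' k, extTerm f k (l k) q) q =
        ∑' k, iteratedFDeriv ℝ i (extTerm f k (l k)) q :=
    iteratedFDeriv_tsum_apply (N := ⊤) hsm (fun i _ => hl i) (fun i k q _ => hbd' i k q) le_top q
  have hG : ContDiff ℝ (⊤ : ℕ∞) fun q => ∑' k, extTerm f k (l k) q :=
    contDiff_tsum (N := ⊤) hsm (fun i _ => hl i) fun i k q _ => hbd' i k q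
  refine ⟨fun q => ∑' k, extTerm f k (l k) q, hG, fun x => ?_, fun i => ?_, fun N x j => ?_⟩
  · simp [extTerm, taylorForm]
  · refine ⟨∑' k, C k i / l k ^ (k + 1) * l k ^ i, fun q => ?_⟩
    rw [hder]
    exact tsum_of_norm_bounded ((hl i).hasSum.mul_right _) fun k => hbd i k q
  · have hcut (k : ℕ) : extTerm f k (l k) =ᶠ[𝓝 (x, 0)]
        fun q => Complex.I ^ (k + 1) / (k + 1).factorial * taylorForm (k + 1) f q := by
      have hopen : IsOpen {q : Eu n × Eu n | l k * ‖q.2‖ < jb q.1} := by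
        refine isOpen_lt (by fun_prop) ?_
        unfold jb
        fun_prop
      have hmem : ((x, 0) : Eu n × Eu n) ∈ {q : Eu n × Eu n | l k * ‖q.2‖ < jb q.1} := by
        simpa using jb_pos x
      filter_upwards [hopen.mem_nhds hmem] with q hq
      rw [extTerm, cutoff_eq_one (zero_le_one.trans (hl1 k)) (le_of_lt hq), one_mul]
    have hform (k : ℕ) : ContDiff ℝ (⊤ : ℕ∞) fun q =>
        Complex.I ^ (k + 1) / (k + 1).factorial * taylorForm (k + 1) f q :=
      contDiff_const.mul (contDiff_taylorForm (k + 1) hf)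
    have hdiff : VanishesToOrder (N + 1) (fun q => (∑' k, extTerm f k (l k) q) -
        ∑ k ∈ Finset.range N,
          Complex.I ^ (k + 1) / (k + 1).factorial * taylorForm (k + 1) f q) (x, 0) := by
      intro m hm
      have hP : ContDiff ℝ (⊤ : ℕ∞) fun q => ∑ k ∈ Finset.range N,
          Complex.I ^ (k + 1) / (k + 1).factorial * taylorForm (k + 1) f q :=
        ContDiff.sum fun k _ => hform k
      rw [fun_iteratedFDeriv_sub_apply (hG.of_le (by exact_mod_cast le_top)).contDiffAt
        (hP.of_le (by exact_mod_cast le_top)).contDiffAt, hder, tsum_eq_sum (s := Finset.range N),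
        iteratedFDeriv_fun_sum_apply, sub_eq_zero]
      · exact Finset.sum_congr rfl fun k _ => ((hcut k).iteratedFDeriv ℝ m).eq_of_nhds
      · exact fun k _ => ((hform k).of_le (by exact_mod_cast le_top)).contDiffAt
      · intro k hk
        rw [((hcut k).iteratedFDeriv ℝ m).eq_of_nhds]
        exact ((vanishesToOrder_taylorForm (k + 1) hf x).mul_left (contDiff_taylorForm (k + 1) hf)
          contDiff_const) m (by simp at hk; omega)
    have hsplit : (fun q : Eu n × Eu n => f q.1 + ∑' k, extTerm f k (l k) q) = fun q =>
        ((∑' k, extTerm f k (l k) q) - ∑ k ∈ Finset.range N,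
          Complex.I ^ (k + 1) / (k + 1).factorial * taylorForm (k + 1) f q) + taylorPoly N f q := by
      ext q
      rw [taylorPoly, Finset.sum_range_succ']
      simp only [taylorForm, pow_zero, Nat.factorial_zero, Nat.cast_one, div_one, one_mul]
      ring
    have hsub := hG.sub (ContDiff.sum (s := Finset.range N) fun k _ => hform k)
    rw [hsplit, dbar_add hsub (contDiff_taylorPoly N hf), dbar_taylorPoly N hf]
    exact (hdiff.dbar hsub j).add
      ((vanishesToOrder_taylorForm N (contDiff_pdE hf j) x).mul_left
        (contDiff_taylorForm N (contDiff_pdE hf j)) contDiff_const) (contDiff_dbar hsub j)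
      (contDiff_const.mul (contDiff_taylorForm N (contDiff_pdE hf j)))

end Extension

section MixedDerivatives

variable {n : ℕ}

lemma norm_iteratedFDeriv_foldr_pdY_le (L : List (Fin n)) {F : Eu n → Eu n → ℂ}
    (hF : ContDiff ℝ (⊤ : ℕ∞) (fun q : Eu n × Eu n => F q.1 q.2)) :
    ContDiff ℝ (⊤ : ℕ∞) (fun q : Eu n × Eu n => L.foldr pdY F q.1 q.2) ∧ ∀ m q,
      ‖iteratedFDeriv ℝ m (fun q : Eu n × Eu n => L.foldr pdY F q.1 q.2) q‖ ≤
        ‖iteratedFDeriv ℝ (m + L.length) (fun q : Eu n × Eu n => F q.1 q.2) q‖ := by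
  induction L with
  | nil => exact ⟨hF, fun m q => le_rfl⟩
  | cons i L ih =>
    simp only [List.foldr_cons, (pdX_pdY_eq_dirDeriv ih.1 i).2]
    refine ⟨contDiff_dirDeriv ih.1 _, fun m q => ?_⟩
    refine (norm_iteratedFDeriv_dirDeriv_le ih.1 _ q m).trans ?_
    rw [Prod.norm_mk, norm_zero, PiLp.norm_single, norm_one, sup_of_le_right zero_le_one, one_mul]
    have h := ih.2 (m + 1) q
    rwa [show m + 1 + L.length = m + (i :: L).length by rw [List.length_cons]; ring] at h

lemma norm_iteratedFDeriv_foldr_pdX_le (L : List (Fin n)) {F : Eu n → Eu n → ℂ}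
    (hF : ContDiff ℝ (⊤ : ℕ∞) (fun q : Eu n × Eu n => F q.1 q.2)) :
    ContDiff ℝ (⊤ : ℕ∞) (fun q : Eu n × Eu n => L.foldr pdX F q.1 q.2) ∧ ∀ m q,
      ‖iteratedFDeriv ℝ m (fun q : Eu n × Eu n => L.foldr pdX F q.1 q.2) q‖ ≤
        ‖iteratedFDeriv ℝ (m + L.length) (fun q : Eu n × Eu n => F q.1 q.2) q‖ := by
  induction L with
  | nil => exact ⟨hF, fun m q => le_rfl⟩
  | cons i L ih =>
    simp only [List.foldr_cons, (pdX_pdY_eq_dirDeriv ih.1 i).1]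
    refine ⟨contDiff_dirDeriv ih.1 _, fun m q => ?_⟩
    refine (norm_iteratedFDeriv_dirDeriv_le ih.1 _ q m).trans ?_
    rw [Prod.norm_mk, norm_zero, PiLp.norm_single, norm_one, sup_of_le_left zero_le_one, one_mul]
    have h := ih.2 (m + 1) q
    rwa [show m + 1 + L.length = m + (i :: L).length by rw [List.length_cons]; ring] at h

lemma norm_mderiv2_le {F : Eu n → Eu n → ℂ}
    (hF : ContDiff ℝ (⊤ : ℕ∞) (fun q : Eu n × Eu n => F q.1 q.2)) (A B : Fin n → ℕ) (x y : Eu n) :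
    ‖mderiv2 A B F x y‖ ≤
      ‖iteratedFDeriv ℝ (mOrd A + mOrd B) (fun q : Eu n × Eu n => F q.1 q.2) (x, y)‖ := by
  have hY := norm_iteratedFDeriv_foldr_pdY_le (mIdx B) hF
  have h1 := (norm_iteratedFDeriv_foldr_pdX_le (mIdx A) hY.1).2 0 (x, y)
  rw [norm_iteratedFDeriv_zero, zero_add] at h1
  rw [← length_mIdx A, ← length_mIdx B]
  exact h1.trans (hY.2 _ _)

end MixedDerivatives

/-- **Lemma V.3.1 (almost analytic extension, case `Ω = ℝⁿ`).** Let `f : ℝⁿ → ℂ` be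
`C^∞` with `|f(x)| ≤ M₀⟨x⟩^{−σ₁}` and `Σ_{|γ|=k} |∂^γ f(x)| ≤ M_k ⟨x⟩^{−(k+σ₃)}` for
`k ≥ 1`, where `0 ≤ σ₁ ≤ σ₃` and `(M_k)` is increasing. Then there is a `C^∞` function
`F(x,y)` on `ℝⁿ × ℝⁿ` with: (i) `F(x,0) = f(x)`; (ii) `|F(x,y)| ≤ C₀⟨x⟩^{−σ₁}`;
(iii) `|∂_x^A ∂_y^B F| ≤ C_{AB} ⟨x⟩^{−(|A|+|B|+σ₃)}` for `|A|+|B| ≥ 1`;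
(iv) `|∂̄_j F(x,y)| ≤ C_N (|y|/⟨x⟩)^N ⟨x⟩^{−(1+σ₃)}` for every `N`, where
`∂̄_j = (1/2)(∂/∂x_j + i ∂/∂y_j)`. -/
theorem statement15 (n : ℕ) (hn : 1 ≤ n) (σ₁ σ₃ : ℝ) (hσ₁ : 0 ≤ σ₁) (hσ₁₃ : σ₁ ≤ σ₃)
    (M : ℕ → ℝ) (hMpos : ∀ k, 0 < M k) (hMmono : Monotone M)
    (f : Eu n → ℂ) (hf : ContDiff ℝ (⊤ : ℕ∞) f)
    (hf0 : ∀ x, ‖f x‖ ≤ M 0 * jb x ^ (-σ₁))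
    (hfk : ∀ k : ℕ, 1 ≤ k → ∀ x : Eu n,
      (∑ γ ∈ Finset.Nat.antidiagonalTuple n k, ‖mderivE γ f x‖) ≤
        M k * jb x ^ (-((k : ℝ) + σ₃))) :
    ∃ F : Eu n → Eu n → ℂ,
      ContDiff ℝ (⊤ : ℕ∞) (fun q : Eu n × Eu n => F q.1 q.2) ∧
      (∀ x, F x 0 = f x) ∧
      (∃ C₀ : ℝ, ∀ x y, ‖F x y‖ ≤ C₀ * jb x ^ (-σ₁)) ∧
      (∀ A B : Fin n → ℕ, 1 ≤ mOrd A + mOrd B → ∃ C : ℝ, ∀ x y,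
        ‖mderiv2 A B F x y‖ ≤ C * jb x ^ (-((mOrd A : ℝ) + (mOrd B : ℝ) + σ₃))) ∧
      (∀ N : ℕ, ∃ C : ℝ, ∀ (j : Fin n) (x y : Eu n),
        ‖(1 / 2 : ℂ) * (pdX j F x y + Complex.I * pdY j F x y)‖ ≤
          C * (‖y‖ / jb x) ^ N * jb x ^ (-(1 + σ₃))) := by
  have hfb (m : ℕ) (hm : 1 ≤ m) (x : Eu n) :
      ‖iteratedFDeriv ℝ m f x‖ ≤ n ^ m * M m * jb x ^ (-((m : ℝ) + σ₃)) := by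
    rw [mul_assoc]
    exact norm_iteratedFDeriv_le_of_mderivE m hf (hfk m hm x)
  obtain ⟨G, hG, hG0, hGb, hGv⟩ :=
    exists_almostAnalytic hf (xBound_pdE hf hfb) (hσ₁.trans hσ₁₃)
  have hf1 : ContDiff ℝ (⊤ : ℕ∞) fun q : Eu n × Eu n => f q.1 := hf.comp contDiff_fst
  have hF : ContDiff ℝ (⊤ : ℕ∞) fun q : Eu n × Eu n => f q.1 + G q := hf1.add hG
  have hFb (i : ℕ) (hi : 1 ≤ i) : ∃ C : ℝ, ∀ q,
      ‖iteratedFDeriv ℝ i (fun q : Eu n × Eu n => f q.1 + G q) q‖ ≤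
        C * jb q.1 ^ (-((i : ℝ) + σ₃)) := by
    obtain ⟨C, hC⟩ := hGb i
    refine ⟨n ^ i * M i + C, fun q => ?_⟩
    rw [fun_iteratedFDeriv_add_apply (hf1.of_le (by exact_mod_cast le_top)).contDiffAt
      (hG.of_le (by exact_mod_cast le_top)).contDiffAt, add_mul]
    exact norm_add_le_of_le ((norm_iteratedFDeriv_comp_fst_le hf i q).trans (hfb i hi q.1)) (hC q)
  refine ⟨fun x y => f x + G (x, y), hF, fun x => by simp [hG0], ?_, fun A B hAB => ?_,
    fun N => ?_⟩
  · obtain ⟨C, hC⟩ := hGb 0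
    refine ⟨M 0 + |C|, fun x y => ?_⟩
    have h1 := hC (x, y)
    rw [norm_iteratedFDeriv_zero, Nat.cast_zero, zero_add] at h1
    rw [add_mul]
    refine norm_add_le_of_le (hf0 x) (h1.trans ?_)
    have := jb_pos x
    gcongr
    · exact le_abs_self C
    · exact one_le_jb x
  · obtain ⟨C, hC⟩ := hFb _ hAB
    refine ⟨C, fun x y => (norm_mderiv2_le (F := fun x y => f x + G (x, y)) hF A B x y).trans ?_⟩
    exact_mod_cast hC (x, y)
  · obtain ⟨C, hC⟩ := hFb (N + 1) (by omega)
    refine ⟨C, fun j x y => ?_⟩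
    have hD : pdX j (fun x y => f x + G (x, y)) x y +
        Complex.I * pdY j (fun x y => f x + G (x, y)) x y =
        dbar j (fun q => f q.1 + G q) (x, y) := by
      have h := pdX_pdY_eq_dirDeriv (F := fun x y => f x + G (x, y)) hF j
      exact congrArg₂ (fun a b => a + Complex.I * b) (congrFun h.1 (x, y)) (congrFun h.2 (x, y))
    have key := VanishesToOrder.norm_le N (q := ((x, 0) : Eu n × Eu n)) (v := (0, y))
      (B := 2 * (C * jb x ^ (-(((N + 1 : ℕ) : ℝ) + σ₃)))) (contDiff_dbar hF j) (hGv N x j)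
      fun t _ => by
        rw [show ((x, 0) : Eu n × Eu n) + t • (0, y) = (x, t • y) by simp]
        exact (norm_iteratedFDeriv_dbar_le hF j N _).trans
          (mul_le_mul_of_nonneg_left (hC (x, t • y)) zero_le_two)
    rw [hD, norm_mul]
    simp only [Prod.mk_add_mk, add_zero, zero_add, Prod.norm_mk, norm_zero,
      sup_of_le_right (norm_nonneg y)] at key
    have e : jb x ^ (-(((N + 1 : ℕ) : ℝ) + σ₃)) =
        jb x ^ (-(1 + σ₃)) * (1 / jb x) ^ N := by
      rw [← jb_rpow_neg_add]
      push_cast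
      ring_nf
    rw [e] at key
    have h2 : ‖(1 / 2 : ℂ)‖ = 1 / 2 := by norm_num
    rw [h2]
    refine (mul_le_mul_of_nonneg_left key (by norm_num)).trans_eq ?_
    rw [div_pow, div_pow, one_pow]
    ring

end Paper
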